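/- Let φ : R → S be a homomorphism of rings (not necessarily commutative), and suppose that S, regarded as a left R-module via φ, admits a finite resolution 0 → P_n → ⋯ → P_1 → P_0 → S → 0 by finitely generated projective left R-modules. Then the functor D(φ) : D(S) → D(R) between unbounded derived categories induced by restriction of scalars is fully faithful if and only if the canonical map S → Hom_R(S, S), s ↦ (x ↦ x s), is bijective and Ext^i_R(S, S) = 0 for all i ≥ 1. -/

import Mathlib

/-!
Homological epimorphisms of rings (Geigle–Lenzing).
`φ : R →+* S`; every `S`-module is an `R`-module by restriction of scalars.
-/

universe w u

open CategoryTheory Limits DerivedCategory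

noncomputable section

namespace RingHomEpi

variable {R S : Type u} [Ring R] [Ring S] (φ : R →+* S)

instance : (ModuleCat.restrictScalars.{u} φ).Additive where
  map_add := rfl

/-- `S` regarded as an `R`-module via `φ`. -/
abbrev SasR : ModuleCat.{u} R := (ModuleCat.restrictScalars φ).obj (ModuleCat.of S S)

/-- The canonical map `η_M : M → Hom_R(S, M)`, `m ↦ (s ↦ s • m)`. -/
def etaMap (M : ModuleCat.{u} S) :
    M → (SasR φ →ₗ[R] (ModuleCat.restrictScalars φ).obj M) := fun m =>
  { toFun := fun s => (show S from s) • (show M from m)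
    map_add' := fun s t => add_smul (show S from s) (show S from t) (show M from m)
    map_smul' := fun r s => by
      show (φ r • (show S from s)) • (show M from m) =
        φ r • ((show S from s) • (show M from m))
      exact smul_assoc (φ r) (show S from s) (show M from m) }

/-- Restriction of scalars is compatible with the forgetful functors to abelian groups. -/
def restrictScalarsCompForget₂Iso :
    ModuleCat.restrictScalars.{u} φ ⋙ forget₂ (ModuleCat.{u} R) AddCommGrpCat ≅
      forget₂ (ModuleCat.{u} S) AddCommGrpCat :=
  NatIso.ofComponents (fun _ => Iso.refl _) (fun _ => rfl)

instance : PreservesFiniteLimits (ModuleCat.restrictScalars.{u} φ) := by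
  have : PreservesFiniteLimits
      (ModuleCat.restrictScalars.{u} φ ⋙ forget₂ (ModuleCat.{u} R) AddCommGrpCat) :=
    preservesFiniteLimits_of_natIso (restrictScalarsCompForget₂Iso φ).symm
  exact preservesFiniteLimits_of_reflects_of_preserves _
    (forget₂ (ModuleCat.{u} R) AddCommGrpCat)

instance : PreservesFiniteColimits (ModuleCat.restrictScalars.{u} φ) := by
  have : PreservesFiniteColimits
      (ModuleCat.restrictScalars.{u} φ ⋙ forget₂ (ModuleCat.{u} R) AddCommGrpCat) :=
    preservesFiniteColimits_of_natIso (restrictScalarsCompForget₂Iso φ).symm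
  exact preservesFiniteColimits_of_reflects_of_preserves _
    (forget₂ (ModuleCat.{u} R) AddCommGrpCat)

attribute [local instance] CategoryTheory.hasExt_of_hasDerivedCategory

variable [HasDerivedCategory.{w} (ModuleCat.{u} R)]
  [HasDerivedCategory.{w} (ModuleCat.{u} S)]

/-- The functor `D(φ) : D(S) → D(R)` induced by restriction of scalars along `φ`. -/
abbrev Dphi : DerivedCategory (ModuleCat.{u} S) ⥤ DerivedCategory (ModuleCat.{u} R) :=
  (ModuleCat.restrictScalars.{u} φ).mapDerivedCategory

/-- `D(φ)` commutes with the single complex functors. -/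
def singleObjIso (M : ModuleCat.{u} S) :
    (Dphi φ).obj ((DerivedCategory.singleFunctor (ModuleCat.{u} S) 0).obj M) ≅
      (DerivedCategory.singleFunctor (ModuleCat.{u} R) 0).obj
        ((ModuleCat.restrictScalars φ).obj M) :=
  (Dphi φ).mapIso
    (((SingleFunctors.evaluation _ _ 0).mapIso
      (DerivedCategory.singleFunctorsPostcompQIso (ModuleCat.{u} S))).app M)
  ≪≫ ((ModuleCat.restrictScalars.{u} φ).mapDerivedCategoryFactors.app _)
  ≪≫ DerivedCategory.Q.mapIso
      ((HomologicalComplex.singleMapHomologicalComplex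
        (ModuleCat.restrictScalars.{u} φ) (ComplexShape.up ℤ) 0).app M)
  ≪≫ (((SingleFunctors.evaluation _ _ 0).mapIso
      (DerivedCategory.singleFunctorsPostcompQIso (ModuleCat.{u} R))).symm.app _)

/-- The natural comparison map `Ext^n_S(M, M') → Ext^n_R(M, M')` induced by
restriction of scalars along `φ`. -/
def extMap {M M' : ModuleCat.{u} S} {n : ℕ} (e : Abelian.Ext.{w} M M' n) :
    Abelian.Ext.{w} ((ModuleCat.restrictScalars φ).obj M)
      ((ModuleCat.restrictScalars φ).obj M') n :=
  Abelian.Ext.homEquiv.symm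
    ((singleObjIso φ M).inv ≫ (Dphi φ).map e.hom ≫
      ((Dphi φ).commShiftIso (n : ℤ)).hom.app _ ≫
      (shiftFunctor (DerivedCategory (ModuleCat.{u} R)) (n : ℤ)).map
        (singleObjIso φ M').hom)


set_option linter.unusedSectionVars false

/-- `Ext^j(A, M) = 0` for all `j > k`. -/
def Acy (A M : ModuleCat.{u} R) (k : ℕ) : Prop :=
  ∀ j : ℕ, k < j → Subsingleton (Abelian.Ext.{w} A M j)

theorem acy_quot {A : ModuleCat.{u} R} {T : ShortComplex (ModuleCat.{u} R)} (hT : T.ShortExact)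
    {k : ℕ} (h1 : Acy.{w} A T.X₁ (k + 1)) (h2 : Acy.{w} A T.X₂ k) : Acy.{w} A T.X₃ k := by
  intro j hj
  refine subsingleton_of_forall_eq 0 fun x => ?_
  have := h1 (j + 1) (by omega)
  have := h2 j hj
  obtain ⟨y, hy⟩ := Abelian.Ext.covariant_sequence_exact₃ A hT x rfl (Subsingleton.elim _ _)
  rw [← hy, Subsingleton.elim y 0]
  simp

theorem acy_ext {A : ModuleCat.{u} R} {T : ShortComplex (ModuleCat.{u} R)} (hT : T.ShortExact)
    {k : ℕ} (h1 : Acy.{w} A T.X₁ k) (h3 : Acy.{w} A T.X₃ k) : Acy.{w} A T.X₂ k := by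
  intro j hj
  refine subsingleton_of_forall_eq 0 fun x => ?_
  have := h1 j hj
  have := h3 j hj
  obtain ⟨y, hy⟩ := Abelian.Ext.covariant_sequence_exact₂ A hT x (Subsingleton.elim _ _)
  rw [← hy, Subsingleton.elim y 0]
  simp

theorem acy_injective (A I : ModuleCat.{u} R) [Injective I] (k : ℕ) : Acy.{w} A I k := by
  intro j hj
  obtain ⟨j, rfl⟩ := Nat.exists_eq_succ_of_ne_zero (Nat.ne_zero_of_lt hj)
  exact @Abelian.Ext.subsingleton_of_injective _ _ _ (CategoryTheory.hasExt_of_hasDerivedCategory.{w} _) A I _ j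

theorem Acy.mono {A M : ModuleCat.{u} R} {k l : ℕ} (h : Acy.{w} A M k) (hkl : k ≤ l) :
    Acy.{w} A M l := fun j hj => h j (by omega)

theorem Acy.of_iso {A M N : ModuleCat.{u} R} {k : ℕ} (h : Acy.{w} A M k) (e : M ≅ N) :
    Acy.{w} A N k := by
  have hT : (ShortComplex.mk (0 : ModuleCat.of R PUnit.{u+1} ⟶ M) e.hom (by simp)).ShortExact :=
    { exact := by
        rw [ShortComplex.exact_iff_mono _ rfl]; dsimp; infer_instance
      mono_f := (ModuleCat.mono_iff_injective _).2 (Function.injective_of_subsingleton _)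
      epi_g := by dsimp; infer_instance }
  have := IsZero.injective (ModuleCat.isZero_of_subsingleton (ModuleCat.of R PUnit.{u+1}))
  exact acy_quot hT (acy_injective _ _ _) h

theorem lift_of_acy {A : ModuleCat.{u} R} {T : ShortComplex (ModuleCat.{u} R)} (hT : T.ShortExact)
    (h1 : Acy.{w} A T.X₁ 0) (f : A ⟶ T.X₃) : ∃ g : A ⟶ T.X₂, g ≫ T.g = f := by
  have : Subsingleton (Abelian.Ext.{w} A T.X₁ (0 + 1)) := h1 1 (by omega)
  obtain ⟨y, hy⟩ := Abelian.Ext.covariant_sequence_exact₃.{w} A hT (Abelian.Ext.mk₀.{w} f) rfl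
    (Subsingleton.elim _ _)
  obtain ⟨g, rfl⟩ := (Abelian.Ext.mk₀_bijective.{w} _ _).2 y
  refine ⟨g, (Abelian.Ext.mk₀_bijective.{w} _ _).1 ?_⟩
  rw [← hy, Abelian.Ext.mk₀_comp_mk₀]

theorem acy_of_resolution {A : ModuleCat.{u} R} (P : ProjectiveResolution A) (n : ℕ)
    (hn : ∀ i : ℕ, n < i → IsZero (P.complex.X i)) (M : ModuleCat.{u} R) : Acy.{w} A M n := by
  intro j hj
  refine subsingleton_of_forall_eq 0 fun x => ?_
  obtain ⟨f, hf, rfl⟩ := P.extMk_surjective x _ rfl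
  obtain rfl : f = 0 := (hn j hj).eq_of_src _ _
  simp

/-- The free `S`-module on `ι`. -/
abbrev Fr (S : Type u) [Ring S] (ι : Type u) : ModuleCat.{u} S := ModuleCat.of S (ι →₀ S)

/-- coordinate map on the restricted free module. -/
def coordR (ι : Type u) (i : ι) :
    (ModuleCat.restrictScalars φ).obj (Fr S ι) ⟶ SasR φ :=
  (ModuleCat.restrictScalars φ).map (ModuleCat.ofHom (Finsupp.lapply i))

/-- inclusion map into the restricted free module. -/
def inclR (ι : Type u) (i : ι) :
    SasR φ ⟶ (ModuleCat.restrictScalars φ).obj (Fr S ι) :=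
  (ModuleCat.restrictScalars φ).map (ModuleCat.ofHom (Finsupp.lsingle i))

theorem free_ext {ι : Type u} (x y : (ModuleCat.restrictScalars φ).obj (Fr S ι))
    (h : ∀ i, coordR φ ι i x = coordR φ ι i y) : x = y :=
  Finsupp.ext (f := (show ι →₀ S from x)) (g := (show ι →₀ S from y)) h

theorem coord_finite {ι : Type u} (x : (ModuleCat.restrictScalars φ).obj (Fr S ι)) :
    {i | coordR φ ι i x ≠ 0}.Finite :=
  ((show ι →₀ S from x).support.finite_toSet).subset fun i hi => by
    exact Finsupp.mem_support_iff.mpr hi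

theorem coord_incl_same (ι : Type u) (i : ι) : inclR φ ι i ≫ coordR φ ι i = 𝟙 _ := by
  classical
  ext x
  exact Finsupp.single_eq_same

theorem coord_incl_ne (ι : Type u) (i j : ι) (h : i ≠ j) : inclR φ ι i ≫ coordR φ ι j = 0 := by
  classical
  ext x
  exact Finsupp.single_eq_of_ne h.symm

theorem coord_finite_map {ι : Type u} {P : ModuleCat.{u} R} [Module.Finite R P]
    (g : P ⟶ (ModuleCat.restrictScalars φ).obj (Fr S ι)) :
    {i | g ≫ coordR φ ι i ≠ 0}.Finite := by
  obtain ⟨s, hs⟩ := Module.Finite.fg_top (R := R) (M := P)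
  refine Set.Finite.subset (Set.Finite.biUnion s.finite_toSet
    (t := fun p => {i | coordR φ ι i (g p) ≠ 0}) fun p _ => coord_finite φ (g p)) ?_
  intro i hi
  by_contra hcon
  simp only [Set.mem_iUnion, Set.mem_ofPred_eq, not_exists, not_not] at hcon
  apply hi
  apply ModuleCat.hom_ext
  apply LinearMap.ext_on hs
  intro p hp
  exact hcon p hp

theorem acy_free (P : ProjectiveResolution (SasR φ))
    (hf : ∀ i : ℕ, Module.Finite R (P.complex.X i))
    (hS : ∀ i : ℕ, 1 ≤ i → Subsingleton (Abelian.Ext.{w} (SasR φ) (SasR φ) i)) (ι : Type u) :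
    Acy.{w} (SasR φ) ((ModuleCat.restrictScalars φ).obj (Fr S ι)) 0 := by
  classical
  intro j hj
  refine subsingleton_of_forall_eq 0 fun x => ?_
  obtain ⟨g, hg, rfl⟩ := P.extMk_surjective x _ rfl
  obtain ⟨j, rfl⟩ := Nat.exists_eq_succ_of_ne_zero (Nat.ne_zero_of_lt hj)
  refine (ProjectiveResolution.extMk_eq_zero_iff.{w} P g _ _ hg j rfl).2 ?_
  have hfin := coord_finite_map φ g
  have key : ∀ i, ∃ h : P.complex.X j ⟶ SasR φ, P.complex.d (j+1) j ≫ h = g ≫ coordR φ ι i := by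
    intro i
    have := hS (j + 1) (by omega)
    exact (ProjectiveResolution.extMk_eq_zero_iff.{w} P (g ≫ coordR φ ι i) _ rfl
      (by rw [reassoc_of% hg, zero_comp]) j rfl).1 (Subsingleton.elim _ _)
  choose h hh using key
  refine ⟨∑ i ∈ hfin.toFinset, h i ≫ inclR φ ι i, ?_⟩
  ext p
  apply free_ext
  intro i
  have : (P.complex.d (j+1) j ≫ ∑ i ∈ hfin.toFinset, h i ≫ inclR φ ι i) ≫ coordR φ ι i
      = g ≫ coordR φ ι i := by
    simp only [Category.assoc, Preadditive.sum_comp, Preadditive.comp_sum]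
    by_cases hi : i ∈ hfin.toFinset
    · rw [Finset.sum_eq_single_of_mem i hi, coord_incl_same, Category.comp_id, hh]
      intro b _ hb
      rw [coord_incl_ne _ _ _ _ hb]; simp
    · rw [Finset.sum_eq_zero]
      · symm; simpa using hi
      · intro b hb
        rw [coord_incl_ne _ _ _ _ (by rintro rfl; exact hi hb)]; simp
  exact congr($this p)

/-- The presentation short complex of `M`. -/
def pres (M : ModuleCat.{u} S) : ShortComplex (ModuleCat.{u} S) :=
  ShortComplex.mk (kernel.ι (ModuleCat.ofHom (Finsupp.linearCombination S (id : M → M)) :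
    Fr S M ⟶ M)) _ (kernel.condition _)

theorem pres_exact (M : ModuleCat.{u} S) : (pres M).ShortExact where
  exact := ShortComplex.exact_kernel _
  mono_f := by dsimp [pres]; infer_instance
  epi_g := by
    dsimp [pres]
    rw [ModuleCat.epi_iff_surjective]
    exact Finsupp.linearCombination_id_surjective S M

theorem acy_restrict (P : ProjectiveResolution (SasR φ)) (n : ℕ)
    (hn : ∀ i : ℕ, n < i → IsZero (P.complex.X i))
    (hf : ∀ i : ℕ, Module.Finite R (P.complex.X i))
    (hS : ∀ i : ℕ, 1 ≤ i → Subsingleton (Abelian.Ext.{w} (SasR φ) (SasR φ) i))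
    (M : ModuleCat.{u} S) :
    Acy.{w} (SasR φ) ((ModuleCat.restrictScalars φ).obj M) 0 := by
  suffices h : ∀ k (M : ModuleCat.{u} S),
      Acy.{w} (SasR φ) ((ModuleCat.restrictScalars φ).obj M) (n - k) by
    simpa using h n M
  intro k
  induction k with
  | zero => exact fun M => acy_of_resolution P n hn _
  | succ k ih =>
    intro M
    exact acy_quot ((pres_exact M).map_of_exact (ModuleCat.restrictScalars φ))
      ((ih _).mono (by omega)) ((acy_free φ P hf hS _).mono (by omega))

theorem eta_injective (M : ModuleCat.{u} S) : Function.Injective (etaMap φ M) := by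
  intro m m' h
  have := LinearMap.congr_fun h (show S from 1)
  change (1 : S) • (show M from m) = (1 : S) • (show M from m') at this
  simpa using this

theorem eta_free (hη : Function.Bijective (etaMap φ (ModuleCat.of S S))) (ι : Type u) :
    Function.Surjective (etaMap φ (Fr S ι)) := by
  intro f
  refine ⟨(show ι →₀ S from f (show S from 1)), ?_⟩
  apply LinearMap.ext
  intro x
  apply free_ext
  intro i
  obtain ⟨s, hs⟩ := hη.2 (ModuleCat.ofHom f ≫ coordR φ ι i).hom
  have h1 : (1 : S) • (show S from s) = coordR φ ι i (f (show S from 1)) :=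
    congrArg (fun l : SasR φ →ₗ[R] SasR φ => l (show S from 1)) hs
  have h2 : (show S from x) • (show S from s) = coordR φ ι i (f x) :=
    congrArg (fun l : SasR φ →ₗ[R] SasR φ => l x) hs
  change (show S from x) • (show S from coordR φ ι i (f (show S from 1))) = coordR φ ι i (f x)
  rw [← h2, ← h1, one_smul]

theorem eta_bijective (hA : ∀ M : ModuleCat.{u} S,
      Acy.{w} (SasR φ) ((ModuleCat.restrictScalars φ).obj M) 0)
    (hη : Function.Bijective (etaMap φ (ModuleCat.of S S))) (M : ModuleCat.{u} S) :
    Function.Bijective (etaMap φ M) := by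
  refine ⟨eta_injective φ M, fun f => ?_⟩
  let f' := ModuleCat.ofHom f
  obtain ⟨g, hg⟩ := lift_of_acy.{w} ((pres_exact M).map_of_exact (ModuleCat.restrictScalars φ))
    (hA _) f'
  obtain ⟨m, hm⟩ := eta_free φ hη M g.hom
  refine ⟨(pres M).g m, ?_⟩
  apply LinearMap.ext
  intro x
  have h1 : (pres M).g (g x) = f x := congr($hg x)
  have h2 : (show S from x) • (show (M →₀ S) from m) = g x := LinearMap.congr_fun hm x
  refine Eq.trans ?_ h1
  rw [← h2]
  exact (((pres M).g.hom).map_smul (show S from x) m).symm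



theorem shortExact_pullback {C : Type*} [Category C] [Abelian C] {T : ShortComplex C}
    (hT : T.ShortExact) {E : C} (p : E ⟶ T.X₃) :
    (ShortComplex.mk (pullback.lift T.f 0 (by rw [T.zero, zero_comp]) : T.X₁ ⟶ pullback T.g p)
      (pullback.snd T.g p) (pullback.lift_snd _ _ _)).ShortExact := by
  have := hT.mono_f
  have := hT.epi_g
  have hm : Mono (pullback.lift T.f 0 (by rw [T.zero, zero_comp]) : T.X₁ ⟶ pullback T.g p) :=
    mono_of_mono_fac (pullback.lift_fst _ _ _)
  refine { exact := ?_, mono_f := hm, epi_g := by dsimp; infer_instance }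
  refine ShortComplex.exact_of_f_is_kernel _ (KernelFork.IsLimit.ofι' _ _ fun {A} k hk => ?_)
  dsimp at k hk
  refine ⟨hT.exact.lift (k ≫ pullback.fst _ _) ?_, ?_⟩
  · rw [Category.assoc, pullback.condition, reassoc_of% hk, zero_comp]
  · apply pullback.hom_ext
    · rw [Category.assoc, pullback.lift_fst]
      exact hT.exact.lift_f _ _
    · rw [Category.assoc, pullback.lift_snd, comp_zero]
      exact hk.symm

open ZeroObject in
theorem isZero_Q_iff {C : Type*} [Category C] [Abelian C] [HasDerivedCategory C]
    (K : CochainComplex C ℤ) : IsZero (Q.obj K) ↔ K.Acyclic := by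
  rw [HomologicalComplex.acyclic_iff]
  have e : ∀ n, K.ExactAt n ↔ IsZero (K.homology n) := fun n => K.exactAt_iff_isZero_homology n
  constructor
  · intro h n
    rw [e]
    exact IsZero.of_iso ((DerivedCategory.homologyFunctor C n).map_isZero h)
      ((DerivedCategory.homologyFunctorFactors C n).app K).symm
  · intro h
    have : QuasiIso (0 : K ⟶ 0) := by
      rw [quasiIso_iff]
      intro n
      rw [quasiIsoAt_iff_isIso_homologyMap]
      have h1 := (e n).1 (h n)
      have h2 : IsZero ((0 : CochainComplex C ℤ).homology n) :=
        (HomologicalComplex.exactAt_iff_isZero_homology _ _).1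
          (HomologicalComplex.acyclic_of_isZero _ (isZero_zero _) n)
      exact isIso_of_source_target_iso_zero _ h1.isoZero h2.isoZero
    exact IsZero.of_iso (Functor.map_isZero Q (isZero_zero _)) (asIso (Q.map (0 : K ⟶ 0)))

open Pretriangulated in
theorem quasiIso_iff_acyclic_cone {C : Type*} [Category C] [Abelian C] [HasDerivedCategory C]
    {K L : CochainComplex C ℤ} (f : K ⟶ L) :
    QuasiIso f ↔ (CochainComplex.mappingCone f).Acyclic := by
  rw [← isZero_Q_iff, ← isIso_Q_map_iff_quasiIso]
  exact (Triangle.isZero₃_iff_isIso₁ _ (mappingCone_triangle_distinguished f)).symm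

open Pretriangulated in
theorem quasiIso_of_ses {C : Type*} [Category C] [Abelian C] [HasDerivedCategory C]
    {T : ShortComplex (CochainComplex C ℤ)} (hT : T.ShortExact) (h3 : T.X₃.Acyclic) :
    QuasiIso T.f := by
  rw [← isZero_Q_iff] at h3
  rw [← isIso_Q_map_iff_quasiIso]
  exact (Triangle.isZero₃_iff_isIso₁ _ (triangleOfSES_distinguished hT)).1 h3

theorem acyclic_cone_id {C : Type*} [Category C] [Abelian C] [HasDerivedCategory C]
    (K : CochainComplex C ℤ) : (CochainComplex.mappingCone (𝟙 K)).Acyclic :=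
  (quasiIso_iff_acyclic_cone _).1 inferInstance

theorem ses_cycles {C : Type*} [Category C] [Abelian C] {K : CochainComplex C ℤ} (hK : K.Acyclic)
    (i : ℤ) : (ShortComplex.mk (K.iCycles i) (K.toCycles i (i + 1))
      (by rw [← cancel_mono (K.iCycles (i + 1))]; simp)).ShortExact := by
  refine { exact := ?_, mono_f := by dsimp; infer_instance, epi_g := ?_ }
  · refine ShortComplex.exact_of_f_is_kernel _ (KernelFork.IsLimit.ofι' _ _ fun {A} k hk => ?_)
    dsimp at k hk
    refine ⟨K.liftCycles k (i + 1) (by simp) ?_, K.liftCycles_i _ _ _ _⟩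
    rw [← K.toCycles_i, reassoc_of% hk, zero_comp]
  · exact Preadditive.epi_of_isZero_cokernel' _ (K.homologyIsCokernel i (i + 1) (by simp))
      ((K.exactAt_iff_isZero_homology _).1 (hK (i + 1)))


theorem acy_cycles {A : ModuleCat.{u} R} (n : ℕ) (hA : ∀ M : ModuleCat.{u} R, Acy.{w} A M n)
    {K : CochainComplex (ModuleCat.{u} R) ℤ} (hK : K.Acyclic)
    (h0 : ∀ i, Acy.{w} A (K.X i) 0) (i : ℤ) : Acy.{w} A (K.cycles i) 0 := by
  suffices h : ∀ (k : ℕ) (i : ℤ), Acy.{w} A (K.cycles i) (n - k) by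
    simpa using h n i
  intro k
  induction k with
  | zero => exact fun i => hA _
  | succ k ih =>
    intro i
    obtain ⟨i, rfl⟩ : ∃ j, i = j + 1 := ⟨i - 1, by simp⟩
    exact acy_quot (ses_cycles hK i) ((ih _).mono (by omega)) ((h0 i).mono (by omega))

theorem lift_complex {A : ModuleCat.{u} R} (n : ℕ) (hA : ∀ M : ModuleCat.{u} R, Acy.{w} A M n)
    {K : CochainComplex (ModuleCat.{u} R) ℤ} (hK : K.Acyclic)
    (h0 : ∀ i, Acy.{w} A (K.X i) 0) (i : ℤ) (f : A ⟶ K.X (i + 1))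
    (hf : f ≫ K.d (i + 1) (i + 1 + 1) = 0) :
    ∃ g : A ⟶ K.X i, g ≫ K.d i (i + 1) = f := by
  obtain ⟨g, hg⟩ := lift_of_acy.{w} (ses_cycles hK i) (acy_cycles n hA hK h0 i)
    (K.liftCycles f _ (by simp) hf)
  dsimp at g hg
  refine ⟨g, ?_⟩
  rw [← K.toCycles_i, reassoc_of% hg, K.liftCycles_i]

instance : (ModuleCat.coextendScalars.{u, u, u} φ).Additive :=
  (ModuleCat.restrictCoextendScalarsAdj φ).right_adjoint_additive

/-- Elements of the coextension of scalars as morphisms. -/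
def cohomEquiv (M : ModuleCat.{u} R) :
    (ModuleCat.coextendScalars.{u, u, u} φ).obj M ≃ (SasR φ ⟶ M) :=
  (ModuleCat.CoextendScalars.equiv φ M).toEquiv.trans ModuleCat.homEquiv.symm

theorem cohomEquiv_map {M N : ModuleCat.{u} R} (g : M ⟶ N)
    (x : (ModuleCat.coextendScalars.{u, u, u} φ).obj M) :
    cohomEquiv φ N ((ModuleCat.coextendScalars.{u, u, u} φ).map g x) = cohomEquiv φ M x ≫ g :=
  rfl

theorem cohomEquiv_zero (M : ModuleCat.{u} R) : cohomEquiv φ M 0 = 0 := rfl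

theorem acyclic_coextend (n : ℕ) (hA : ∀ M : ModuleCat.{u} R, Acy.{w} (SasR φ) M n)
    {K : CochainComplex (ModuleCat.{u} R) ℤ} (hK : K.Acyclic)
    (h0 : ∀ i, Acy.{w} (SasR φ) (K.X i) 0) :
    (((ModuleCat.coextendScalars.{u, u, u} φ).mapHomologicalComplex _).obj K).Acyclic := by
  intro i
  obtain ⟨i, rfl⟩ : ∃ j, i = j + 1 := ⟨i - 1, by simp⟩
  rw [HomologicalComplex.exactAt_iff' _ i (i + 1) (i + 1 + 1) (by simp) (by simp),
    ShortComplex.moduleCat_exact_iff]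
  intro x hx
  obtain ⟨g, hg⟩ := lift_complex n hA hK h0 i (cohomEquiv φ _ x) (by
    have := congrArg (cohomEquiv φ _) hx
    exact this)
  refine ⟨(cohomEquiv φ _).symm g, ?_⟩
  apply (cohomEquiv φ _).injective
  refine (cohomEquiv_map φ _ _).trans ?_
  rw [Equiv.apply_symm_apply]
  exact hg

theorem acy_biprod {A M N : ModuleCat.{u} R} {k : ℕ} (hM : Acy.{w} A M k) (hN : Acy.{w} A N k) :
    Acy.{w} A (M ⊞ N) k :=
  acy_ext (T := ShortComplex.mk (biprod.inl : M ⟶ M ⊞ N) biprod.snd (by simp))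
    (ShortComplex.Splitting.ofHasBinaryBiproduct M N).shortExact hM hN

theorem acy_cone {A : ModuleCat.{u} R} {K L : CochainComplex (ModuleCat.{u} R) ℤ} (f : K ⟶ L)
    {k : ℕ} (hK : ∀ i, Acy.{w} A (K.X i) k) (hL : ∀ i, Acy.{w} A (L.X i) k) (i : ℤ) :
    Acy.{w} A ((CochainComplex.mappingCone f).X i) k :=
  (acy_biprod (hK (i + 1)) (hL i)).of_iso
    (HomologicalComplex.homotopyCofiber.XIsoBiprod f i (i + 1) rfl).symm

theorem coextend_quasiIso (n : ℕ) (hA : ∀ M : ModuleCat.{u} R, Acy.{w} (SasR φ) M n)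
    {K L : CochainComplex (ModuleCat.{u} R) ℤ} (f : K ⟶ L) [hf : QuasiIso f]
    (hK : ∀ i, Acy.{w} (SasR φ) (K.X i) 0) (hL : ∀ i, Acy.{w} (SasR φ) (L.X i) 0) :
    QuasiIso (((ModuleCat.coextendScalars.{u, u, u} φ).mapHomologicalComplex _).map f) := by
  rw [quasiIso_iff_acyclic_cone] at hf ⊢
  have h := acyclic_coextend φ n hA hf (acy_cone f hK hL)
  rw [← isZero_Q_iff] at h ⊢
  exact h.of_iso (Q.mapIso (CochainComplex.mappingCone.mapHomologicalComplexIso f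
    (ModuleCat.coextendScalars.{u, u, u} φ)).symm)

theorem resolve_step {A : ModuleCat.{u} R} {k : ℕ} {Z : CochainComplex (ModuleCat.{u} R) ℤ}
    (hZ : ∀ i, Acy.{w} A (Z.X i) (k + 1)) :
    ∃ (Z' : CochainComplex (ModuleCat.{u} R) ℤ) (s : Z ⟶ Z'), QuasiIso s ∧
      ∀ i, Acy.{w} A (Z'.X i) k := by
  let D := CochainComplex.mappingCone (𝟙 (CochainComplex.cm5b.I Z))
  let ι : Z ⟶ D := CochainComplex.cm5b.i (𝟙 Z) ≫ biprod.fst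
  have hι : Mono ι := by
    refine HomologicalComplex.mono_of_mono_f _ fun n => ?_
    have h : ι.f n ≫ (CochainComplex.mappingCone.snd _).v n n (add_zero n) =
        Injective.ι (Z.X n) := by
      simpa [ι] using CochainComplex.cm5b.i_f_comp (𝟙 Z) n
    have hm : Mono (ι.f n ≫ (CochainComplex.mappingCone.snd _).v n n (add_zero n)) := by
      rw [h]
      exact Injective.ι_mono (Z.X n)
    exact mono_of_mono _ ((CochainComplex.mappingCone.snd _).v n n (add_zero n))
  have hD : ∀ i, Injective (D.X i) := fun i => by dsimp only [D]; infer_instance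
  let Qc := cokernel ι
  let T₁ : ShortComplex (CochainComplex (ModuleCat.{u} R) ℤ) :=
    ShortComplex.mk ι (cokernel.π ι) (cokernel.condition ι)
  have hT₁ : T₁.ShortExact :=
    { exact := ShortComplex.exact_cokernel ι
      mono_f := hι
      epi_g := by dsimp [T₁]; infer_instance }
  have hQ : ∀ i, Acy.{w} A (Qc.X i) k := fun i =>
    acy_quot (hT₁.map_of_exact (HomologicalComplex.eval _ _ i)) (hZ i)
      (acy_injective A (D.X i) k)
  let Y : CochainComplex (ModuleCat.{u} R) ℤ := Qc⟦(-1 : ℤ)⟧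
  have hY : ∀ i, Acy.{w} A (Y.X i) k := fun i => hQ _
  let T₀ := CochainComplex.mappingCone.triangleRotateShortComplex (𝟙 Y)
  have hT₀ : ∀ n, (T₀.map (HomologicalComplex.eval _ _ n)).ShortExact := fun n =>
    (CochainComplex.mappingCone.triangleRotateShortComplexSplitting (𝟙 Y) n).shortExact
  let e : Qc ≅ T₀.X₃ := (shiftFunctorCompIsoId _ (-1 : ℤ) 1 (by simp)).symm.app Qc
  let T₂ : ShortComplex (CochainComplex (ModuleCat.{u} R) ℤ) :=
    ShortComplex.mk ι (cokernel.π ι ≫ e.hom) (by simp)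
  have hT₂ : T₂.ShortExact :=
    ShortComplex.shortExact_of_iso (ShortComplex.isoMk (S₁ := T₁) (S₂ := T₂) (Iso.refl _) (Iso.refl _) e
      (by simp [T₁, T₂]) (by simp [T₁, T₂])) hT₁
  have h := shortExact_pullback hT₂ (T₀.g : T₀.X₂ ⟶ T₂.X₃)
  refine ⟨_, _, quasiIso_of_ses h (acyclic_cone_id Y), fun i => ?_⟩
  have hT₀' : T₀.ShortExact := HomologicalComplex.shortExact_of_degreewise_shortExact _ hT₀
  have h' := (shortExact_pullback hT₀' (T₂.g : T₂.X₂ ⟶ T₀.X₃)).map_of_exact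
    (HomologicalComplex.eval _ _ i)
  have := acy_ext h' (hY i) (acy_injective A (D.X i) k)
  exact this.of_iso ((HomologicalComplex.eval _ _ i).mapIso (pullbackSymmetry _ _))

theorem resolve {A : ModuleCat.{u} R} (n : ℕ) (hA : ∀ M : ModuleCat.{u} R, Acy.{w} A M n)
    (Z : CochainComplex (ModuleCat.{u} R) ℤ) :
    ∃ (Z' : CochainComplex (ModuleCat.{u} R) ℤ) (s : Z ⟶ Z'), QuasiIso s ∧
      ∀ i, Acy.{w} A (Z'.X i) 0 := by
  suffices h : ∀ (m : ℕ) (Z : CochainComplex (ModuleCat.{u} R) ℤ),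
      (∀ i, Acy.{w} A (Z.X i) m) →
      ∃ (Z' : CochainComplex (ModuleCat.{u} R) ℤ) (s : Z ⟶ Z'), QuasiIso s ∧
        ∀ i, Acy.{w} A (Z'.X i) 0 from h n Z fun i => hA _
  intro m
  induction m with
  | zero => exact fun Z hZ => ⟨Z, 𝟙 Z, inferInstance, hZ⟩
  | succ m ih =>
    intro Z hZ
    obtain ⟨Z₁, s₁, hs₁, h₁⟩ := resolve_step hZ
    obtain ⟨Z₂, s₂, hs₂, h₂⟩ := ih Z₁ h₁
    exact ⟨Z₂, s₁ ≫ s₂, inferInstance, h₂⟩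


/-- The unit of the adjunction, on complexes. -/
def etaC (K : CochainComplex (ModuleCat.{u} S) ℤ) :
    K ⟶ ((ModuleCat.coextendScalars.{u, u, u} φ).mapHomologicalComplex _).obj
      (((ModuleCat.restrictScalars.{u} φ).mapHomologicalComplex _).obj K) where
  f i := (ModuleCat.restrictCoextendScalarsAdj.{u, u, u} φ).unit.app (K.X i)
  comm' i j _ := ((ModuleCat.restrictCoextendScalarsAdj.{u, u, u} φ).unit.naturality (K.d i j)).symm

/-- The counit of the adjunction, on complexes. -/
def epsC (K : CochainComplex (ModuleCat.{u} R) ℤ) :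
    ((ModuleCat.restrictScalars.{u} φ).mapHomologicalComplex _).obj
      (((ModuleCat.coextendScalars.{u, u, u} φ).mapHomologicalComplex _).obj K) ⟶ K where
  f i := (ModuleCat.restrictCoextendScalarsAdj.{u, u, u} φ).counit.app (K.X i)
  comm' i j _ :=
    ((ModuleCat.restrictCoextendScalarsAdj.{u, u, u} φ).counit.naturality (K.d i j)).symm

theorem eta_eps (K : CochainComplex (ModuleCat.{u} S) ℤ) (L : CochainComplex (ModuleCat.{u} R) ℤ)
    (f : ((ModuleCat.restrictScalars.{u} φ).mapHomologicalComplex _).obj K ⟶ L) :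
    ((ModuleCat.restrictScalars.{u} φ).mapHomologicalComplex _).map
      (etaC φ K ≫ ((ModuleCat.coextendScalars.{u, u, u} φ).mapHomologicalComplex _).map f) ≫
      epsC φ L = f := by
  ext i : 1
  let adj := ModuleCat.restrictCoextendScalarsAdj.{u, u, u} φ
  exact (adj.homEquiv_counit _ _ _).symm.trans
    ((adj.homEquiv _ _).symm_apply_eq.2 (adj.homEquiv_unit _ _ _).symm)

theorem isIso_unit (M : ModuleCat.{u} S) (h : Function.Bijective (etaMap φ M)) :
    IsIso ((ModuleCat.restrictCoextendScalarsAdj.{u, u, u} φ).unit.app M) := by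
  rw [ConcreteCategory.isIso_iff_bijective]
  have h' : Function.Bijective ((cohomEquiv φ ((ModuleCat.restrictScalars φ).obj M)).symm ∘
    ModuleCat.homEquiv.symm ∘ etaMap φ M) :=
      (Equiv.bijective _).comp ((Equiv.bijective _).comp h)
  exact h'

theorem isIso_etaC (h : ∀ M, Function.Bijective (etaMap φ M))
    (K : CochainComplex (ModuleCat.{u} S) ℤ) : IsIso (etaC φ K) := by
  have : ∀ i, IsIso ((etaC φ K).f i) := fun i => isIso_unit φ _ (h _)
  exact HomologicalComplex.Hom.isIso_of_components _

theorem full_Q (n : ℕ) (hA : ∀ M : ModuleCat.{u} R, Acy.{w} (SasR φ) M n)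
    (hF : ∀ M : ModuleCat.{u} S, Acy.{w} (SasR φ) ((ModuleCat.restrictScalars φ).obj M) 0)
    (h : ∀ M, Function.Bijective (etaMap φ M))
    (K L : CochainComplex (ModuleCat.{u} S) ℤ)
    (α : (Dphi φ).obj (Q.obj K) ⟶ (Dphi φ).obj (Q.obj L)) :
    ∃ β : Q.obj K ⟶ Q.obj L, (Dphi φ).map β = α := by
  let F := ModuleCat.restrictScalars.{u} φ
  let FC := F.mapHomologicalComplex (ComplexShape.up ℤ)
  let GC := (ModuleCat.coextendScalars.{u, u, u} φ).mapHomologicalComplex (ComplexShape.up ℤ)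
  let e := F.mapDerivedCategoryFactors
  obtain ⟨Z, g, s, hs, hα⟩ := left_fac (e.inv.app K ≫ α ≫ e.hom.app L :
    Q.obj (FC.obj K) ⟶ Q.obj (FC.obj L))
  obtain ⟨Z', t, ht, hZ'⟩ := resolve.{w} n hA Z
  have hs' : QuasiIso s := (isIso_Q_map_iff_quasiIso _ s).1 hs
  let g' := g ≫ t
  let s' := s ≫ t
  have hst : QuasiIso s' := inferInstance
  have hα' : (e.inv.app K ≫ α ≫ e.hom.app L) ≫ Q.map s' = Q.map g' := by
    rw [hα]
    simp [s', g']
  have hG := coextend_quasiIso φ n hA s' (fun i => hF _) hZ'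
  have hη := isIso_etaC φ h L
  let s'' := etaC φ L ≫ GC.map s'
  have hs'' : QuasiIso s'' := by
    dsimp only [s'']
    infer_instance
  let g'' := etaC φ K ≫ GC.map g'
  refine ⟨Q.map g'' ≫ inv (Q.map s''), ?_⟩
  have e1 : FC.map g'' ≫ epsC φ Z' = g' := eta_eps φ K Z' g'
  have e2 : FC.map s'' ≫ epsC φ Z' = s' := eta_eps φ L Z' s'
  have n1 : (Dphi φ).map (Q.map g'') ≫ e.hom.app _ ≫ Q.map (epsC φ Z') =
      e.hom.app K ≫ Q.map g' := by
    have e' : Q.map g' = Q.map (FC.map g'') ≫ Q.map (epsC φ Z') := by rw [← Q.map_comp, e1]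
    rw [e']
    exact F.mapDerivedCategoryFactors_hom_naturality_assoc g'' _
  have n2 : (Dphi φ).map (Q.map s'') ≫ e.hom.app _ ≫ Q.map (epsC φ Z') =
      e.hom.app L ≫ Q.map s' := by
    have e' : Q.map s' = Q.map (FC.map s'') ≫ Q.map (epsC φ Z') := by rw [← Q.map_comp, e2]
    rw [e']
    exact F.mapDerivedCategoryFactors_hom_naturality_assoc s'' _
  have hi : IsIso (e.hom.app L ≫ Q.map s') := inferInstance
  have key : (Dphi φ).map (Q.map g'' ≫ inv (Q.map s'')) ≫ (e.hom.app L ≫ Q.map s') =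
      α ≫ (e.hom.app L ≫ Q.map s') := by
    rw [Functor.map_comp, Category.assoc, ← n2, Functor.map_inv, IsIso.inv_hom_id_assoc, n1,
      ← hα', n2]
    simp
  exact (cancel_mono _).1 key

theorem full_of (n : ℕ) (hA : ∀ M : ModuleCat.{u} R, Acy.{w} (SasR φ) M n)
    (hF : ∀ M : ModuleCat.{u} S, Acy.{w} (SasR φ) ((ModuleCat.restrictScalars φ).obj M) 0)
    (h : ∀ M, Function.Bijective (etaMap φ M)) : (Dphi φ).Full where
  map_surjective {X Y} α := by
    let eX := Q.objObjPreimageIso X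
    let eY := Q.objObjPreimageIso Y
    obtain ⟨β, hβ⟩ := full_Q φ n hA hF h _ _ ((Dphi φ).map eX.hom ≫ α ≫ (Dphi φ).map eY.inv)
    refine ⟨eX.inv ≫ β ≫ eY.hom, ?_⟩
    rw [Functor.map_comp, Functor.map_comp, hβ]
    simp [← Functor.map_comp, ← Functor.map_comp_assoc]

instance : (ModuleCat.restrictScalars.{u} φ).PreservesHomology := inferInstance

theorem isZero_of_Dphi (X : DerivedCategory (ModuleCat.{u} S)) (h : IsZero ((Dphi φ).obj X)) :
    IsZero X := by
  let eX := Q.objObjPreimageIso X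
  refine IsZero.of_iso ?_ eX.symm
  rw [isZero_Q_iff]
  have h1 : IsZero ((Dphi φ).obj (Q.obj (Q.objPreimage X))) := h.of_iso ((Dphi φ).mapIso eX)
  have h2 := h1.of_iso ((ModuleCat.restrictScalars.{u} φ).mapDerivedCategoryFactors.app _).symm
  have h3 := (isZero_Q_iff _).1 h2
  intro i
  exact (ShortComplex.exact_map_iff_of_faithful _ (ModuleCat.restrictScalars.{u} φ)).1 (h3 i)

open Pretriangulated in
theorem isIso_of_Dphi {X Y : DerivedCategory (ModuleCat.{u} S)} (f : X ⟶ Y)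
    (h : IsIso ((Dphi φ).map f)) : IsIso f := by
  obtain ⟨Z, g, k, hT⟩ := distinguished_cocone_triangle f
  refine (Triangle.isZero₃_iff_isIso₁ _ hT).1 (isZero_of_Dphi φ _ ?_)
  exact (Triangle.isZero₃_iff_isIso₁ _ ((Dphi φ).map_distinguished _ hT)).2 h

open Pretriangulated in
theorem faithful_of_full (hfull : (Dphi φ).Full) : (Dphi φ).Faithful := by
  have key : ∀ {X Y : DerivedCategory (ModuleCat.{u} S)} (f : X ⟶ Y),
      (Dphi φ).map f = 0 → f = 0 := by
    intro X Y f hf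
    obtain ⟨Z, g, k, hT⟩ := distinguished_cocone_triangle f
    obtain ⟨r, hr⟩ : ∃ r : (Dphi φ).obj Z ⟶ (Dphi φ).obj Y, 𝟙 _ = (Dphi φ).map g ≫ r :=
      Triangle.yoneda_exact₂ _ ((Dphi φ).map_distinguished _ hT) (𝟙 ((Dphi φ).obj Y))
        (by change (Dphi φ).map f ≫ 𝟙 _ = 0; rw [hf, zero_comp])
    obtain ⟨r', rfl⟩ := (Dphi φ).map_surjective r
    have hi : IsIso (g ≫ r') := isIso_of_Dphi φ _ (by
      have : (Dphi φ).map (g ≫ r') = 𝟙 _ := by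
        rw [Functor.map_comp]; exact hr.symm
      rw [this]; infer_instance)
    have h0 : f ≫ g = 0 := comp_distTriang_mor_zero₁₂ _ hT
    rw [← cancel_mono (g ≫ r'), reassoc_of% h0, zero_comp, zero_comp]
  refine ⟨fun {X Y f g} hfg => sub_eq_zero.1 (key _ ?_)⟩
  rw [Functor.map_sub, hfg, sub_self]


theorem ext_of_full (hfull : (Dphi φ).Full) (i : ℕ) (hi : 1 ≤ i) :
    Subsingleton (Abelian.Ext.{w} (SasR φ) (SasR φ) i) := by
  have hsub : Subsingleton (Abelian.Ext.{w} (ModuleCat.of S S) (ModuleCat.of S S) i) := by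
    have : Projective (ModuleCat.of.{u} S S) := inferInstance
    obtain ⟨j, rfl⟩ : ∃ j, i = j + 1 := ⟨i - 1, by omega⟩
    exact @Abelian.Ext.subsingleton_of_projective _ _ _
      (CategoryTheory.hasExt_of_hasDerivedCategory.{w} _) _ _ _ _
  have hsurj : ∀ x : Abelian.Ext.{w} (SasR φ) (SasR φ) i,
      ∃ y : Abelian.Ext.{w} (ModuleCat.of S S) (ModuleCat.of S S) i, extMap φ y = x := by
    intro x
    obtain ⟨β, hβ⟩ := (Dphi φ).map_surjective ((singleObjIso φ (ModuleCat.of S S)).hom ≫ x.hom ≫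
      (shiftFunctor (DerivedCategory (ModuleCat.{u} R)) (i : ℤ)).map
        (singleObjIso φ (ModuleCat.of S S)).inv ≫ ((Dphi φ).commShiftIso (i : ℤ)).inv.app _)
    obtain ⟨y, h1⟩ : ∃ y : Abelian.Ext.{w} (ModuleCat.of S S) (ModuleCat.of S S) i, y.hom = β :=
      Abelian.Ext.homEquiv.surjective β
    refine ⟨y, ?_⟩
    unfold extMap
    rw [Equiv.symm_apply_eq, h1, hβ]
    simp only [Category.assoc, Iso.inv_hom_id_app_assoc, Iso.inv_hom_id_assoc,
      ← Functor.map_comp, Iso.inv_hom_id]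
    simp
  refine ⟨fun a b => ?_⟩
  obtain ⟨a', rfl⟩ := hsurj a
  obtain ⟨b', rfl⟩ := hsurj b
  rw [Subsingleton.elim a' b']

theorem eta_of_full (hfull : (Dphi φ).Full) :
    Function.Bijective (etaMap φ (ModuleCat.of S S)) := by
  refine ⟨eta_injective φ _, fun f => ?_⟩
  let f' := ModuleCat.ofHom f
  let F := ModuleCat.restrictScalars.{u} φ
  let e := F.mapDerivedCategorySingleFunctor 0
  obtain ⟨β, hβ⟩ := (Dphi φ).map_surjective (e.hom.app (ModuleCat.of S S) ≫
    (DerivedCategory.singleFunctor (ModuleCat.{u} R) 0).map f' ≫ e.inv.app (ModuleCat.of S S))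
  obtain ⟨g, rfl⟩ := (DerivedCategory.singleFunctor (ModuleCat.{u} S) 0).map_surjective β
  have h1 : F.map g = f' := by
    apply (DerivedCategory.singleFunctor (ModuleCat.{u} R) 0).map_injective
    have := e.hom.naturality g
    rw [← cancel_epi (e.hom.app (ModuleCat.of S S))]
    refine this.symm.trans ?_
    refine (congrArg (· ≫ e.hom.app (ModuleCat.of S S)) hβ).trans ?_
    simp only [Category.assoc, Iso.inv_hom_id_app]
    exact congrArg _ (Category.comp_id _)
  have h2 : (F.map g).hom = f := congrArg ModuleCat.Hom.hom h1
  refine ⟨g.hom (1 : S), ?_⟩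
  refine LinearMap.ext fun x => ?_
  have h3 := congrArg (fun l : SasR φ →ₗ[R] SasR φ => l x) h2
  refine Eq.trans ?_ h3
  have h4 := g.hom.map_smul (show S from x) (1 : S)
  refine h4.symm.trans ?_
  refine congrArg g.hom ?_
  exact mul_one (show S from x)

/-- Let `φ : R →+* S` be a ring homomorphism such that `S`, as a left `R`-module via `φ`,
admits a finite resolution by finitely generated projective left `R`-modules. Then
`D(φ) : D(S) → D(R)` is fully faithful if and only if the canonical map
`S → Hom_R(S,S)`, `s ↦ (x ↦ x * s)`, is bijective and `Ext^i_R(S,S) = 0` for all `i ≥ 1`. -/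
theorem derived_fully_faithful_iff_eta_S_bijective_and_ext_vanishing
    (hres : ∃ (P : ProjectiveResolution (SasR φ)) (n : ℕ),
      (∀ i : ℕ, Module.Finite R (P.complex.X i)) ∧
      (∀ i : ℕ, n < i → IsZero (P.complex.X i))) :
    ((Dphi φ).Full ∧ (Dphi φ).Faithful) ↔
    (Function.Bijective (etaMap φ (ModuleCat.of S S)) ∧
      ∀ i : ℕ, 1 ≤ i → Subsingleton (Abelian.Ext.{w} (SasR φ) (SasR φ) i)) := by
  obtain ⟨P, n, hf, hn⟩ := hres
  constructor
  · rintro ⟨hfull, -⟩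
    exact ⟨eta_of_full φ hfull, fun i hi => ext_of_full φ hfull i hi⟩
  · rintro ⟨hη, hS⟩
    have hA : ∀ M : ModuleCat.{u} R, Acy.{w} (SasR φ) M n := fun M => acy_of_resolution P n hn M
    have hF := acy_restrict φ P n hn hf hS
    have hfull := full_of φ n hA hF (eta_bijective φ hF hη)
    exact ⟨hfull, faithful_of_full φ hfull⟩

end RingHomEpi
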